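/- Let x ∈ JT be a positive vector (x ≥ 0). Then x is an extreme point of the ball of radius ‖x‖_{JT} if and only if x is separated. -/

import Mathlib

/-! Common framework for the James Tree space `JT`.

The dyadic tree is modelled as `List Bool`, ordered by `List.IsPrefix` (`<+:`). -/

abbrev DyadicNode := List Bool

namespace JTSpace

/-- A segment of the dyadic tree: a linearly ordered, order-convex subset. -/
def IsSegment (S : Set DyadicNode) : Prop :=
  (∀ a ∈ S, ∀ b ∈ S, a <+: b ∨ b <+: a) ∧
  (∀ a ∈ S, ∀ b ∈ S, ∀ c : DyadicNode, a <+: c → c <+: b → c ∈ S)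

/-- A partition: a family of pairwise disjoint segments. -/
def IsPartition (P : Set (Set DyadicNode)) : Prop :=
  (∀ S ∈ P, IsSegment S) ∧ P.PairwiseDisjoint id

/-- The sum of `x` along a set of nodes. -/
noncomputable def segSum (x : DyadicNode → ℝ) (S : Set DyadicNode) : ℝ :=
  ∑' a : S, x a

/-- The square of the value `‖x‖_P` of `x` on the partition `P`. -/
noncomputable def pNormSq (x : DyadicNode → ℝ) (P : Set (Set DyadicNode)) : ℝ :=
  ∑' S : P, (segSum x S) ^ 2

/-- The set of all values `‖x‖_P²` over partitions `P`. -/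
def normSqSet (x : DyadicNode → ℝ) : Set ℝ :=
  {r | ∃ P, IsPartition P ∧ r = pNormSq x P}

/-- The square of the `JT` norm. -/
noncomputable def JTnormSq (x : DyadicNode → ℝ) : ℝ := sSup (normSqSet x)

/-- The `JT` norm of `x`. -/
noncomputable def JTnorm (x : DyadicNode → ℝ) : ℝ := Real.sqrt (JTnormSq x)

/-- The `ℓ₂` norm of `x`. -/
noncomputable def l2norm (x : DyadicNode → ℝ) : ℝ := Real.sqrt (∑' a, (x a) ^ 2)

def HasBddNorm (x : DyadicNode → ℝ) : Prop := BddAbove (normSqSet x)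

/-- `x` belongs to the James Tree space: its norm is finite and it is approximable in the
`JT` norm by finitely supported functions (`JT` is the completion of `c₀₀(T)`). -/
def MemJT (x : DyadicNode → ℝ) : Prop :=
  HasBddNorm x ∧
  ∀ ε > (0 : ℝ), ∃ y : DyadicNode → ℝ, (Function.support y).Finite ∧
    HasBddNorm (x - y) ∧ JTnorm (x - y) ≤ ε

/-- An `x`-norming partition. -/
def IsNormingPartition (x : DyadicNode → ℝ) (P : Set (Set DyadicNode)) : Prop :=
  IsPartition P ∧ pNormSq x P = JTnormSq x

/-- A complete subtree of the dyadic tree. -/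
def IsCompleteSubtree (K : Set DyadicNode) : Prop :=
  ∀ a ∈ K, ∀ b ∈ K, ∀ c : DyadicNode, a <+: c → c <+: b → c ∈ K

/-- The range of `x`: the smallest complete subtree containing the support of `x`. -/
def ran (x : DyadicNode → ℝ) : Set DyadicNode :=
  ⋂₀ {K | IsCompleteSubtree K ∧ Function.support x ⊆ K}

/-- `x` is separated: every two distinct nodes of `ran x` are separated by some
`x`-norming partition. -/
def Separated (x : DyadicNode → ℝ) : Prop :=
  ∀ a ∈ ran x, ∀ b ∈ ran x, a ≠ b →
    ∃ P, IsNormingPartition x P ∧ ∃ S ∈ P, ∃ S' ∈ P, S ≠ S' ∧ a ∈ S ∧ b ∈ S'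

/-- `x` is an extreme point of the ball of radius `‖x‖_{JT}`. -/
def IsExtremePoint (x : DyadicNode → ℝ) : Prop :=
  x ≠ 0 ∧
  ∀ y z : DyadicNode → ℝ, MemJT y → MemJT z →
    ∀ l : ℝ, 0 < l → l < 1 → x = l • y + (1 - l) • z →
      JTnorm y = JTnorm x → JTnorm z = JTnorm x → y = x ∧ z = x

/-- A branch: a maximal segment. -/
def IsBranch (b : Set DyadicNode) : Prop :=
  IsSegment b ∧ ∀ S : Set DyadicNode, IsSegment S → b ⊆ S → S = b

/-- The wedge rooted at `a`. -/
def wedge (a : DyadicNode) : Set DyadicNode := {b | a <+: b}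

/-- The two children of a node. -/
def children (u : DyadicNode) : Set DyadicNode := {u ++ [false], u ++ [true]}

/-- The maximal segment sum starting at `a`:
`S_a(x) = sup { S_s(x) : s a segment with min s = a }`. -/
noncomputable def maxSum (x : DyadicNode → ℝ) (a : DyadicNode) : ℝ :=
  sSup {r | ∃ s : Set DyadicNode, IsSegment s ∧ a ∈ s ∧ (∀ b ∈ s, a <+: b) ∧ r = segSum x s}

/-- The children of `u` within the subtree spanned by the support of `x`. -/
def supportedChildren (x : DyadicNode → ℝ) (u : DyadicNode) : Set DyadicNode :=
  {c ∈ children u | ∃ b ∈ Function.support x, c <+: b}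

/-- A greedy partition for a positive vector `x`: a partition whose segments cover the
support of `x` and such that every segment, at every support node `u` which has a strict
descendant in the support, continues through a child of `u` (within the subtree spanned by
the support) maximizing the maximal segment sum, down to the next element of the support;
at support nodes with no strict descendant in the support, the segment's support ends. -/
def IsGreedyPartition (x : DyadicNode → ℝ) (P : Set (Set DyadicNode)) : Prop :=
  IsPartition P ∧ Function.support x ⊆ ⋃₀ P ∧
  ∀ s ∈ P, ∀ u ∈ s ∩ Function.support x,
    ((∃ w ∈ Function.support x, u <+: w ∧ u ≠ w) →
      ∃ v ∈ s ∩ Function.support x, u <+: v ∧ u ≠ v ∧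
        (∀ w ∈ s ∩ Function.support x, u <+: w → u ≠ w → v <+: w) ∧
        ∃ c ∈ supportedChildren x u, c <+: v ∧
          ∀ k ∈ supportedChildren x u, maxSum x k ≤ maxSum x c) ∧
    ((¬ ∃ w ∈ Function.support x, u <+: w ∧ u ≠ w) →
      ∀ w ∈ s ∩ Function.support x, w <+: u)


open Filter Topology Function

theorem segSum_eq (x : DyadicNode → ℝ) (A : Set DyadicNode) :
    segSum x A = ∑' a, A.indicator x a := tsum_subtype A x

theorem segSum_empty (x : DyadicNode → ℝ) : segSum x ∅ = 0 := by
  simp [segSum]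

theorem fam_sum_le {ι : Type} {y : DyadicNode → ℝ} (hb : HasBddNorm y)
    {S : ι → Set DyadicNode} (hseg : ∀ i, IsSegment (S i))
    (hdis : ∀ i j, i ≠ j → Disjoint (S i) (S j)) (s : Finset ι) :
    ∑ i ∈ s, segSum y (S i) ^ 2 ≤ JTnormSq y := by
  classical
  set t := s.filter (fun i => (S i).Nonempty) with ht
  have h1 : ∑ i ∈ s, segSum y (S i) ^ 2 = ∑ i ∈ t, segSum y (S i) ^ 2 := by
    rw [ht, Finset.sum_filter]
    refine Finset.sum_congr rfl fun i _ => ?_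
    split_ifs with h
    · rfl
    · rw [Set.not_nonempty_iff_eq_empty.1 h, segSum_empty]; norm_num
  have hinj : Set.InjOn S t := by
    intro i hi j hj hij
    by_contra hne
    have hd := hdis i j hne
    have hn : (S i).Nonempty := (Finset.mem_filter.1 hi).2
    rw [← hij, disjoint_self] at hd
    exact hn.ne_empty hd
  have h2 : ∑ i ∈ t, segSum y (S i) ^ 2 = pNormSq y (↑(t.image S) : Set (Set DyadicNode)) := by
    rw [← Finset.sum_image (f := fun A => segSum y A ^ 2) hinj]
    unfold pNormSq
    exact (Finset.tsum_subtype (t.image S) (fun A => segSum y A ^ 2)).symm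
  rw [h1, h2]
  refine le_csSup hb ⟨_, ⟨?_, ?_⟩, rfl⟩
  · intro A hA
    obtain ⟨i, _, rfl⟩ := Finset.mem_image.1 (Finset.mem_coe.1 hA)
    exact hseg i
  · intro A hA B hB hAB
    obtain ⟨i, _, rfl⟩ := Finset.mem_image.1 (Finset.mem_coe.1 hA)
    obtain ⟨j, _, rfl⟩ := Finset.mem_image.1 (Finset.mem_coe.1 hB)
    exact hdis i j (fun h => hAB (by rw [h]))

theorem fam_summable {ι : Type} {y : DyadicNode → ℝ} (hb : HasBddNorm y)
    {S : ι → Set DyadicNode} (hseg : ∀ i, IsSegment (S i))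
    (hdis : ∀ i j, i ≠ j → Disjoint (S i) (S j)) :
    Summable (fun i => segSum y (S i) ^ 2) :=
  summable_of_sum_le (fun _ => sq_nonneg _) (fam_sum_le hb hseg hdis)

theorem fam_tsum_le {ι : Type} {y : DyadicNode → ℝ} (hb : HasBddNorm y)
    {S : ι → Set DyadicNode} (hseg : ∀ i, IsSegment (S i))
    (hdis : ∀ i j, i ≠ j → Disjoint (S i) (S j)) :
    ∑' i, segSum y (S i) ^ 2 ≤ JTnormSq y :=
  (fam_summable hb hseg hdis).tsum_le_of_sum_le (fam_sum_le hb hseg hdis)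

theorem IsPartition.disj {P : Set (Set DyadicNode)} (hP : IsPartition P) (A B : P)
    (h : A ≠ B) : Disjoint (A : Set DyadicNode) B :=
  hP.2 A.2 B.2 (fun h' => h (Subtype.ext h'))

theorem JTnormSq_nonneg (y : DyadicNode → ℝ) : 0 ≤ JTnormSq y := by
  apply Real.sSup_nonneg
  rintro r ⟨P, _, rfl⟩
  exact tsum_nonneg fun _ => sq_nonneg _

/-- the finite ball of the tree -/
noncomputable def ball (n : ℕ) : Finset DyadicNode := (List.finite_length_le Bool n).toFinset

theorem mem_ball {n : ℕ} {a : DyadicNode} : a ∈ ball n ↔ a.length ≤ n := by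
  simp [ball]

theorem tendsto_ball : Tendsto ball atTop atTop := by
  apply tendsto_atTop_finset_of_monotone
  · intro m n h a
    simp only [mem_ball]; omega
  · intro a; exact ⟨a.length, by simp [mem_ball]⟩

/-- truncated sums -/
noncomputable def fs (f : DyadicNode → ℝ) (n : ℕ) (A : Set DyadicNode) : ℝ :=
  ∑ a ∈ ball n, A.indicator f a

theorem fs_eq (f : DyadicNode → ℝ) (n : ℕ) (A : Set DyadicNode) :
    segSum f (A ∩ ↑(ball n)) = fs f n A := by
  rw [segSum_eq, fs, tsum_eq_sum (s := ball n)]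
  · refine Finset.sum_congr rfl fun a ha => ?_
    by_cases h : a ∈ A <;> simp [h, ha, Set.indicator]
  · intro a ha
    simp [ha]

theorem IsSegment.inter {A C : Set DyadicNode} (hA : IsSegment A)
    (hC : ∀ a ∈ C, ∀ b ∈ C, ∀ c : DyadicNode, a <+: c → c <+: b → c ∈ C) :
    IsSegment (A ∩ C) :=
  ⟨fun a ha b hb => hA.1 a ha.1 b hb.1,
   fun a ha b hb c h1 h2 => ⟨hA.2 a ha.1 b hb.1 c h1 h2, hC a ha.2 b hb.2 c h1 h2⟩⟩

theorem IsSegment.ball {A : Set DyadicNode} (hA : IsSegment A) (n : ℕ) :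
    IsSegment (A ∩ ↑(ball n)) := by
  apply hA.inter
  intro a _ b hb c _ h2
  have := h2.length_le
  rw [Finset.mem_coe, mem_ball] at *
  omega

/-- summability on segments for nonnegative vectors -/
theorem seg_summable {x : DyadicNode → ℝ} (hb : HasBddNorm x) (hpos : ∀ a, 0 ≤ x a)
    {A : Set DyadicNode} (hA : IsSegment A) : Summable (A.indicator x) := by
  have hnn : ∀ a, 0 ≤ A.indicator x a := fun a => Set.indicator_nonneg (fun a _ => hpos a) a
  refine summable_of_sum_le hnn (c := JTnormSq x + 1) fun u => ?_
  obtain ⟨n, hn⟩ := (tendsto_atTop.1 tendsto_ball u).exists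
  have h1 : ∑ a ∈ u, A.indicator x a ≤ fs x n A :=
    Finset.sum_le_sum_of_subset_of_nonneg hn fun a _ _ => hnn a
  have h2 := fam_sum_le (ι := Unit) hb (S := fun _ => A ∩ ↑(ball n)) (fun _ => hA.ball n)
    (fun i j h => (h rfl).elim) Finset.univ
  simp only [fs_eq, Finset.univ_unique, Finset.sum_const, Finset.card_singleton, one_smul] at h2
  nlinarith [sq_nonneg (fs x n A - 1)]

theorem summable_sub {x : DyadicNode → ℝ} (hpos : ∀ a, 0 ≤ x a)
    {A B : Set DyadicNode} (hA : Summable (A.indicator x)) (h : B ⊆ A) :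
    Summable (B.indicator x) := by
  refine Summable.of_nonneg_of_le (fun a => Set.indicator_nonneg (fun a _ => hpos a) a) ?_ hA
  exact fun a => Set.indicator_le_indicator_of_subset h hpos a

theorem segSum_nonneg {x : DyadicNode → ℝ} (hpos : ∀ a, 0 ≤ x a) (A : Set DyadicNode) :
    0 ≤ segSum x A := tsum_nonneg fun _ => hpos _

theorem segSum_mono {x : DyadicNode → ℝ} (hpos : ∀ a, 0 ≤ x a)
    {A B : Set DyadicNode} (hA : Summable (A.indicator x)) (h : B ⊆ A) :
    segSum x B ≤ segSum x A := by
  rw [segSum_eq, segSum_eq]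
  exact (summable_sub hpos hA h).tsum_le_tsum
    (fun a => Set.indicator_le_indicator_of_subset h hpos a) hA

theorem segSum_congr {x : DyadicNode → ℝ} {A B : Set DyadicNode}
    (h : ∀ a, x a ≠ 0 → (a ∈ A ↔ a ∈ B)) : segSum x A = segSum x B := by
  classical
  rw [segSum_eq, segSum_eq]
  congr 1
  ext a
  by_cases ha : x a = 0
  · simp [Set.indicator, ha]
  · simp [Set.indicator, h a ha]

theorem segSum_union {x : DyadicNode → ℝ} {A B C : Set DyadicNode}
    (hA : Summable (A.indicator x)) (hB : Summable (B.indicator x)) (hd : Disjoint A B)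
    (h : ∀ a, x a ≠ 0 → (a ∈ C ↔ a ∈ A ∨ a ∈ B)) :
    segSum x C = segSum x A + segSum x B := by
  rw [segSum_congr (B := A ∪ B) h, segSum_eq, segSum_eq, segSum_eq,
    ← hA.tsum_add hB]
  congr 1
  ext a
  exact congrFun (Set.indicator_union_of_disjoint hd x) a

theorem segSum_singleton (x : DyadicNode → ℝ) (a : DyadicNode) : segSum x {a} = x a := by
  simp [segSum]

theorem summable_singleton (x : DyadicNode → ℝ) (a : DyadicNode) :
    Summable (({a} : Set DyadicNode).indicator x) := by
  apply summable_of_ne_finset_zero (s := {a})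
  intro b hb
  simp at hb
  simp [hb]

theorem le_segSum {x : DyadicNode → ℝ} (hpos : ∀ a, 0 ≤ x a)
    {A : Set DyadicNode} (hA : Summable (A.indicator x)) {a : DyadicNode} (h : a ∈ A) :
    x a ≤ segSum x A := by
  rw [← segSum_singleton x a]
  exact segSum_mono hpos hA (by simpa using h)

theorem segSum_zero {x : DyadicNode → ℝ} {A : Set DyadicNode} (h : ∀ a ∈ A, x a = 0) :
    segSum x A = 0 := by
  rw [segSum_congr (B := ∅), segSum_empty]
  intro a ha
  simp only [Set.mem_empty_iff_false, iff_false]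
  exact fun h' => ha (h a h')

theorem isSegment_singleton (a : DyadicNode) : IsSegment {a} := by
  constructor
  · rintro b rfl c rfl; exact Or.inl (List.prefix_refl _)
  · rintro b rfl c rfl d h1 h2
    exact (h2.eq_of_length_le h1.length_le)

theorem tendsto_fs {x : DyadicNode → ℝ} {A : Set DyadicNode} (hA : Summable (A.indicator x)) :
    Tendsto (fun n => fs x n A) atTop (𝓝 (segSum x A)) := by
  rw [segSum_eq]
  exact hA.hasSum.comp tendsto_ball

/-- norming families of segments -/
structure NF (x : DyadicNode → ℝ) {ι : Type} (S : ι → Set DyadicNode) : Prop where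
  seg : ∀ i, IsSegment (S i)
  dis : ∀ i j, i ≠ j → Disjoint (S i) (S j)
  nrm : JTnormSq x ≤ ∑' i, segSum x (S i) ^ 2

theorem NF.of_norming {x : DyadicNode → ℝ} {P : Set (Set DyadicNode)}
    (h : IsNormingPartition x P) : NF x (fun A : P => (A : Set DyadicNode)) :=
  ⟨fun A => h.1.1 A A.2, fun A B hAB => h.1.disj A B hAB, h.2.ge⟩

/-- truncated sums tend to zero -/
def Null (f : DyadicNode → ℝ) (A : Set DyadicNode) : Prop :=
  Tendsto (fun n => fs f n A) atTop (𝓝 0)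

theorem fs_comb (y z : DyadicNode → ℝ) (l m : ℝ) (n : ℕ) (A : Set DyadicNode) :
    fs (l • y + m • z) n A = l * fs y n A + m * fs z n A := by
  simp only [fs, Finset.mul_sum, ← Finset.sum_add_distrib]
  refine Finset.sum_congr rfl fun a _ => ?_
  by_cases h : a ∈ A <;> simp [h]

theorem NF.null {x y z : DyadicNode → ℝ} (hx : HasBddNorm x) (hpos : ∀ a, 0 ≤ x a)
    (hy : HasBddNorm y) (hz : HasBddNorm z) {l : ℝ} (hl0 : 0 < l) (hl1 : l < 1)
    (hxyz : x = l • y + (1 - l) • z) (hny : JTnormSq y = JTnormSq x)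
    (hnz : JTnormSq z = JTnormSq x) {ι : Type} {S : ι → Set DyadicNode} (hS : NF x S) (i : ι) :
    Null (y - z) (S i) := by
  classical
  have key : ∀ ε > 0, ∀ᶠ n in atTop, l * (1 - l) * fs (y - z) n (S i) ^ 2 ≤ ε := by
    intro ε hε
    have hsm := fam_summable hx hS.seg hS.dis
    have h1 : ∀ᶠ s in atTop, JTnormSq x - ε < ∑ j ∈ s, segSum x (S j) ^ 2 :=
      hsm.hasSum.eventually (lt_mem_nhds (by linarith [hS.nrm]))
    obtain ⟨s, hs, his⟩ := (h1.and (eventually_ge_atTop {i})).exists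
    have h2 : Tendsto (fun n => ∑ j ∈ s, fs x n (S j) ^ 2) atTop
        (𝓝 (∑ j ∈ s, segSum x (S j) ^ 2)) :=
      tendsto_finsetSum _ fun j _ => (tendsto_fs (seg_summable hx hpos (hS.seg j))).pow 2
    filter_upwards [h2.eventually (lt_mem_nhds hs)] with n hn
    have hd : ∀ j k, j ≠ k → Disjoint (S j ∩ ↑(ball n)) (S k ∩ ↑(ball n)) := fun j k hjk =>
      (hS.dis j k hjk).mono Set.inter_subset_left Set.inter_subset_left
    have hY := fam_sum_le hy (S := fun j => S j ∩ ↑(ball n)) (fun j => (hS.seg j).ball n) hd s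
    have hZ := fam_sum_le hz (S := fun j => S j ∩ ↑(ball n)) (fun j => (hS.seg j).ball n) hd s
    simp only [fs_eq] at hY hZ
    have hid : ∑ j ∈ s, fs x n (S j) ^ 2 = l * ∑ j ∈ s, fs y n (S j) ^ 2
        + (1 - l) * ∑ j ∈ s, fs z n (S j) ^ 2
        - ∑ j ∈ s, l * (1 - l) * fs (y - z) n (S j) ^ 2 := by
      rw [Finset.mul_sum, Finset.mul_sum, ← Finset.sum_add_distrib, ← Finset.sum_sub_distrib]
      refine Finset.sum_congr rfl fun j _ => ?_
      have e1 : fs x n (S j) = l * fs y n (S j) + (1 - l) * fs z n (S j) := by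
        rw [hxyz, fs_comb]
      have e2 : fs (y - z) n (S j) = fs y n (S j) - fs z n (S j) := by
        have := fs_comb y z 1 (-1) n (S j)
        simpa [sub_eq_add_neg] using this
      rw [e1, e2]; ring
    have hll : 0 ≤ l * (1 - l) := by nlinarith
    have hi : l * (1 - l) * fs (y - z) n (S i) ^ 2
        ≤ ∑ j ∈ s, l * (1 - l) * fs (y - z) n (S j) ^ 2 :=
      Finset.single_le_sum (f := fun j => l * (1 - l) * fs (y - z) n (S j) ^ 2)
        (fun j _ => mul_nonneg hll (sq_nonneg _)) (his (by simp))
    rw [hny] at hY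
    rw [hnz] at hZ
    nlinarith
  have hll : 0 < l * (1 - l) := by nlinarith
  refine Metric.tendsto_atTop.2 fun ε hε => ?_
  have := key (l * (1 - l) * (ε / 2) ^ 2) (by positivity)
  obtain ⟨N, hN⟩ := eventually_atTop.1 this
  refine ⟨N, fun n hn => ?_⟩
  have h3 := le_of_mul_le_mul_left (hN n hn) hll
  have h4 := abs_le_of_sq_le_sq h3 (by linarith)
  rw [Real.dist_eq, sub_zero, abs_lt]
  constructor <;> linarith [(abs_le.1 h4).1, (abs_le.1 h4).2]

section ops

variable {x : DyadicNode → ℝ} {ι : Type} {S : ι → Set DyadicNode}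

theorem NF.of_eq (hS : NF x S) {S' : ι → Set DyadicNode} (hseg : ∀ i, IsSegment (S' i))
    (hdis : ∀ i j, i ≠ j → Disjoint (S' i) (S' j))
    (h : ∀ i, segSum x (S' i) = segSum x (S i)) : NF x S' :=
  ⟨hseg, hdis, by simpa [h] using hS.nrm⟩

theorem NF.shrink (hS : NF x S) (i : ι) {B : Set DyadicNode} (hB : IsSegment B) (hsub : B ⊆ S i)
    (h : segSum x B = segSum x (S i)) : ∃ S' : ι → Set DyadicNode, NF x S' ∧ S' i = B := by
  classical
  have hle : ∀ j, update S i B j ⊆ S j := by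
    intro j
    by_cases hj : j = i
    · subst hj; simpa using hsub
    · simp [hj]
  refine ⟨update S i B, hS.of_eq ?_ ?_ ?_, by simp⟩
  · intro j
    by_cases hj : j = i
    · subst hj; simpa using hB
    · simpa [hj] using hS.seg j
  · exact fun j k hjk => (hS.dis j k hjk).mono (hle j) (hle k)
  · intro j
    by_cases hj : j = i
    · subst hj; simpa using h
    · simp [hj]

theorem NF.add (hx : HasBddNorm x) (hS : NF x S) (a : DyadicNode) (ha : ∀ i, a ∉ S i) :
    x a = 0 ∧ NF x (fun o : Option ι => o.elim {a} S) := by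
  have hseg : ∀ o : Option ι, IsSegment (o.elim {a} S) := by
    rintro (_ | i)
    · exact isSegment_singleton a
    · exact hS.seg i
  have hdis : ∀ o o' : Option ι, o ≠ o' →
      Disjoint (o.elim {a} S : Set DyadicNode) (o'.elim {a} S) := by
    rintro (_ | i) (_ | j) h
    · exact (h rfl).elim
    · simpa using ha j
    · simpa using ha i
    · exact hS.dis i j (fun h' => h (by rw [h']))
  have hsm := fam_summable hx hseg hdis
  have hn := hS.nrm
  have hle : ∑' i, segSum x (S i) ^ 2 ≤ JTnormSq x - x a ^ 2 := by
    refine (fam_summable hx hS.seg hS.dis).tsum_le_of_sum_le fun s => ?_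
    have := fam_sum_le hx hseg hdis (Finset.insertNone s)
    rw [Finset.sum_insertNone] at this
    simp only [Option.elim, segSum_singleton] at this
    linarith
  refine ⟨?_, hseg, hdis, hn.trans ?_⟩
  · nlinarith
  · exact tsum_comp_le_tsum_of_inj hsm (fun _ => sq_nonneg _) (Option.some_injective ι)

theorem NF.cover (hx : HasBddNorm x) (hS : NF x S) {a : DyadicNode} (ha : x a ≠ 0) : ∃ i, a ∈ S i := by
  by_contra h
  push Not at h
  exact ha (hS.add hx a h).1

theorem pfx_antisymm {a b : DyadicNode} (h : a <+: b) (h' : b <+: a) : a = b :=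
  h.eq_of_length_le h'.length_le

theorem pfx_total {a b c : DyadicNode} (h : a <+: c) (h' : b <+: c) : a <+: b ∨ b <+: a :=
  List.prefix_or_prefix_of_prefix h h'

def OI (d w : DyadicNode) : Set DyadicNode := {e | d <+: e ∧ e ≠ d ∧ e <+: w ∧ e ≠ w}

/-- strict upper part of a set -/
def up (A : Set DyadicNode) (d : DyadicNode) : Set DyadicNode := {e | e ∈ A ∧ d <+: e ∧ e ≠ d}

def upe (A : Set DyadicNode) (d : DyadicNode) : Set DyadicNode := {e | e ∈ A ∧ d <+: e}

def dn (A : Set DyadicNode) (d : DyadicNode) : Set DyadicNode := {e | e ∈ A ∧ e <+: d}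

theorem IsSegment.up {A : Set DyadicNode} (hA : IsSegment A) (d : DyadicNode) :
    IsSegment (up A d) := by
  refine ⟨fun a ha b hb => hA.1 a ha.1 b hb.1, fun a ha b hb c h1 h2 => ?_⟩
  refine ⟨hA.2 a ha.1 b hb.1 c h1 h2, ha.2.1.trans h1, ?_⟩
  rintro rfl
  exact ha.2.2 (pfx_antisymm h1 ha.2.1)

theorem IsSegment.upe {A : Set DyadicNode} (hA : IsSegment A) (d : DyadicNode) :
    IsSegment (upe A d) :=
  ⟨fun a ha b hb => hA.1 a ha.1 b hb.1, fun a ha b hb c h1 h2 =>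
    ⟨hA.2 a ha.1 b hb.1 c h1 h2, ha.2.trans h1⟩⟩

theorem IsSegment.dn {A : Set DyadicNode} (hA : IsSegment A) (d : DyadicNode) :
    IsSegment (dn A d) :=
  ⟨fun a ha b hb => hA.1 a ha.1 b hb.1, fun a ha b hb c h1 h2 =>
    ⟨hA.2 a ha.1 b hb.1 c h1 h2, h2.trans hb.2⟩⟩

/-- The exchanged segment. -/
theorem isSegment_join {A B : Set DyadicNode} (hA : IsSegment A) (hB : IsSegment B)
    {d w : DyadicNode} (hd : d ∈ A) (hw : w ∈ B) (hdw : d <+: w) :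
    IsSegment (dn A d ∪ OI d w ∪ upe B w) := by
  constructor
  · rintro a ((ha | ha) | ha) b ((hb | hb) | hb)
    · exact hA.1 a ha.1 b hb.1
    · exact Or.inl (ha.2.trans hb.1)
    · exact Or.inl (ha.2.trans (hdw.trans hb.2))
    · exact Or.inr (hb.2.trans ha.1)
    · exact pfx_total ha.2.2.1 hb.2.2.1
    · exact Or.inl (ha.2.2.1.trans hb.2)
    · exact Or.inr (hb.2.trans (hdw.trans ha.2))
    · exact Or.inr (hb.2.2.1.trans ha.2)
    · exact hB.1 a ha.1 b hb.1
  · intro a ha b hb c h1 h2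
    have low : c <+: d → c ∈ dn A d := by
      intro hcd
      rcases ha with (ha | ha) | ha
      · exact ⟨hA.2 a ha.1 d hd c h1 hcd, hcd⟩
      · exact (ha.2.1 (pfx_antisymm (h1.trans hcd) ha.1)).elim
      · have : c = d := pfx_antisymm hcd (hdw.trans (ha.2.trans h1))
        exact ⟨this ▸ hd, hcd⟩
    have mid : c <+: w → c ∈ dn A d ∪ OI d w ∪ upe B w := by
      intro hcw
      by_cases hcd : c <+: d
      · exact Or.inl (Or.inl (low hcd))
      · by_cases hcw' : c = w
        · subst hcw'; exact Or.inr ⟨hw, List.prefix_refl _⟩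
        · refine Or.inl (Or.inr ⟨(pfx_total hcw hdw).resolve_left hcd, ?_, hcw, hcw'⟩)
          rintro rfl; exact hcd (List.prefix_refl _)
    rcases hb with (hb | hb) | hb
    · exact Or.inl (Or.inl (low (h2.trans hb.2)))
    · exact mid (h2.trans hb.2.2.1)
    · rcases pfx_total h2 hb.2 with h | h
      · exact mid h
      · exact Or.inr ⟨hB.2 w hw b hb.1 c h h2, h⟩

theorem NF.exch (hx : HasBddNorm x) (hpos : ∀ a, 0 ≤ x a) (hS : NF x S) {i j : ι} (hij : i ≠ j) {d w : DyadicNode} (hd : d ∈ S i)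
    (hw : w ∈ S j) (hdw : d <+: w) (hz : ∀ e ∈ OI d w, x e = 0) :
    segSum x (dn (S i) d) * segSum x (upe (S j) w)
      ≤ segSum x (dn (S i) d) * segSum x (up (S i) d) ∧
    (segSum x (up (S i) d) ≤ segSum x (upe (S j) w) →
      ∃ F : ι → Set DyadicNode, NF x F ∧ F j = up (S i) d \ OI d w) := by
  classical
  have hdj : d ∉ S j := Set.disjoint_left.1 (hS.dis i j hij) hd
  set F : ι → Set DyadicNode := fun k =>
    if k = i then dn (S i) d ∪ OI d w ∪ upe (S j) w
    else if k = j then up (S i) d \ OI d w else S k \ OI d w with hF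
  have Fi : F i = dn (S i) d ∪ OI d w ∪ upe (S j) w := by simp [hF]
  have Fj : F j = up (S i) d \ OI d w := by simp [hF, hij.symm]
  have Fk : ∀ k, k ≠ i → k ≠ j → F k = S k \ OI d w := by
    intro k h1 h2; simp [hF, h1, h2]
  have hseg : ∀ k, IsSegment (F k) := by
    intro k
    by_cases hk : k = i
    · subst hk; rw [Fi]; exact isSegment_join (hS.seg _) (hS.seg j) hd hw hdw
    by_cases hk' : k = j
    · subst hk'; rw [Fj]
      have hu := (hS.seg i).up d
      refine ⟨fun a ha b hb => hu.1 a ha.1 b hb.1, fun a ha b hb c h1 h2 =>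
        ⟨hu.2 a ha.1 b hb.1 c h1 h2, fun hc => ha.2 ?_⟩⟩
      refine ⟨ha.1.2.1, ha.1.2.2, h1.trans hc.2.2.1, ?_⟩
      rintro rfl
      exact hc.2.2.2 (pfx_antisymm hc.2.2.1 h1)
    · rw [Fk k hk hk']
      have hdk : d ∉ S k := Set.disjoint_left.1 (hS.dis i k (Ne.symm hk)) hd
      have hu := hS.seg k
      refine ⟨fun a ha b hb => hu.1 a ha.1 b hb.1, fun a ha b hb c h1 h2 =>
        ⟨hu.2 a ha.1 b hb.1 c h1 h2, fun hc => ha.2 ?_⟩⟩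
      rcases pfx_total h1 hc.1 with h | h
      · exact (hdk (hu.2 a ha.1 b hb.1 d h (hc.1.trans h2))).elim
      · refine ⟨h, ?_, h1.trans hc.2.2.1, ?_⟩
        · rintro rfl; exact hdk ha.1
        · rintro rfl; exact hc.2.2.2 (pfx_antisymm hc.2.2.1 h1)
  have hdis : ∀ k l, k ≠ l → Disjoint (F k) (F l) := by
    have D : ∀ k l, k ≠ l → ∀ a, a ∈ S k → a ∈ S l → False := fun k l hkl a h1 h2 =>
      Set.disjoint_left.1 (hS.dis k l hkl) h1 h2
    have main : ∀ k, k ≠ i → Disjoint (F i) (F k) := by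
      intro k hk
      rw [Fi, Set.disjoint_left]
      by_cases hk' : k = j
      · subst hk'
        rw [Fj]
        rintro a ((ha | ha) | ha) hb
        · exact hb.1.2.2 (pfx_antisymm ha.2 hb.1.2.1)
        · exact hb.2 ha
        · exact D _ _ hk _ ha.1 hb.1.1
      · rw [Fk k hk hk']
        rintro a ((ha | ha) | ha) hb
        · exact D _ _ hk _ hb.1 ha.1
        · exact hb.2 ha
        · exact D _ _ hk' _ hb.1 ha.1
    have main2 : ∀ k, k ≠ i → k ≠ j → Disjoint (F j) (F k) := by
      intro k hk hk'
      rw [Fj, Fk k hk hk', Set.disjoint_left]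
      intro a ha hb
      exact D _ _ hk _ hb.1 ha.1.1
    intro k l hkl
    by_cases hk : k = i
    · subst hk; exact main l hkl.symm
    by_cases hl : l = i
    · subst hl; exact (main k hk).symm
    by_cases hk' : k = j
    · subst hk'; exact main2 l hl hkl.symm
    by_cases hl' : l = j
    · subst hl'; exact (main2 k hk hkl).symm
    rw [Fk k hk hk', Fk l hl hl']
    exact (hS.dis k l hkl).mono Set.sdiff_subset Set.sdiff_subset
  have sm : ∀ {A : Set DyadicNode}, IsSegment A → Summable (A.indicator x) :=
    fun h => seg_summable hx hpos h
  set a := segSum x (dn (S i) d)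
  set s := segSum x (up (S i) d)
  set v := segSum x (upe (S j) w)
  have hSi : segSum x (S i) = a + s := by
    refine segSum_union (sm ((hS.seg i).dn d)) (sm ((hS.seg i).up d)) ?_ ?_
    · rw [Set.disjoint_left]
      intro e h1 h2
      exact h2.2.2 (pfx_antisymm h1.2 h2.2.1)
    · intro e _
      constructor
      · intro he
        by_cases h : e <+: d
        · exact Or.inl ⟨he, h⟩
        · refine Or.inr ⟨he, ((hS.seg i).1 e he d hd).resolve_left h, ?_⟩
          rintro rfl; exact h (List.prefix_refl _)
      · rintro (h | h) <;> exact h.1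
  have hSj : segSum x (S j) = v := by
    refine segSum_congr fun e he => ⟨fun h => ⟨h, ?_⟩, fun h => h.1⟩
    rcases (hS.seg j).1 w hw e h with h' | h'
    · exact h'
    · rcases pfx_total h' hdw with h'' | h''
      · exact (hdj ((hS.seg j).2 e h w hw d h'' hdw)).elim
      · by_contra hwe
        refine he (hz e ⟨h'', ?_, h', ?_⟩)
        · rintro rfl; exact hdj h
        · rintro rfl; exact hwe (List.prefix_refl _)
  have hFi : segSum x (F i) = a + v := by
    rw [Fi]
    refine segSum_union (sm ((hS.seg i).dn d)) (sm ((hS.seg j).upe w)) ?_ ?_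
    · exact (hS.dis i j hij).mono (fun _ h => h.1) (fun _ h => h.1)
    · intro e he
      constructor
      · rintro ((h | h) | h)
        · exact Or.inl h
        · exact (he (hz e h)).elim
        · exact Or.inr h
      · rintro (h | h)
        · exact Or.inl (Or.inl h)
        · exact Or.inr h
  have hFj : segSum x (F j) = s := by
    rw [Fj]
    exact segSum_congr fun e he => ⟨fun h => h.1, fun h => ⟨h, fun h' => he (hz e h')⟩⟩
  have hFk : ∀ k, k ≠ i → k ≠ j → segSum x (F k) = segSum x (S k) := by
    intro k h1 h2
    rw [Fk k h1 h2]
    exact segSum_congr fun e he => ⟨fun h => h.1, fun h => ⟨h, fun h' => he (hz e h')⟩⟩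
  have hdiff : ∑' k, segSum x (F k) ^ 2 - ∑' k, segSum x (S k) ^ 2
      = ((a + v) ^ 2 - (a + s) ^ 2) + (s ^ 2 - v ^ 2) := by
    rw [← (fam_summable hx hseg hdis).tsum_sub (fam_summable hx hS.seg hS.dis),
      tsum_eq_sum (s := {i, j})]
    · rw [Finset.sum_pair hij, hFi, hFj, hSi, hSj]
    · intro k hk
      simp only [Finset.mem_insert, Finset.mem_singleton, not_or] at hk
      rw [hFk k hk.1 hk.2, sub_self]
  have h1 := fam_tsum_le hx hseg hdis
  have h2 := hS.nrm
  refine ⟨by nlinarith, fun hsv => ⟨F, ⟨hseg, hdis, ?_⟩, Fj⟩⟩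
  have ha : 0 ≤ a := segSum_nonneg hpos _
  nlinarith [mul_nonneg ha (sub_nonneg.2 hsv)]

end ops

theorem pfx_len_lt {a b : DyadicNode} (h : a <+: b) (hne : b ≠ a) : a.length < b.length := by
  by_contra hlt
  exact hne (h.eq_of_length_le (by omega)).symm

/-- the set of prefixes of a node -/
def pre (t : DyadicNode) : Set DyadicNode := {e | e <+: t}

theorem isSegment_pre (t : DyadicNode) : IsSegment (pre t) :=
  ⟨fun _ ha _ hb => pfx_total ha hb, fun _ _ _ hb _ _ h2 => h2.trans hb⟩

theorem exists_min_len {A : Set DyadicNode} (hA : A.Nonempty) :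
    ∃ w ∈ A, ∀ e ∈ A, w.length ≤ e.length := by
  obtain ⟨w, hw, h⟩ := (measure (List.length (α := Bool))).wf.has_min A hA
  exact ⟨w, hw, fun e he => not_lt.1 (h e he)⟩

theorem exists_max_len {A : Set DyadicNode} (hA : A.Nonempty) {t : DyadicNode}
    (ht : ∀ e ∈ A, e <+: t) :
    ∃ w ∈ A, ∀ e ∈ A, e.length ≤ w.length := by
  obtain ⟨w, hw, h⟩ :=
    (measure (fun e : DyadicNode => t.length - e.length)).wf.has_min A hA
  refine ⟨w, hw, fun e he => ?_⟩
  have h1 : ¬ (t.length - e.length < t.length - w.length) := h e he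
  have h2 := (ht e he).length_le
  have h3 := (ht w hw).length_le
  omega

theorem segSum_upe {x : DyadicNode → ℝ} (hx : HasBddNorm x) (hpos : ∀ a, 0 ≤ x a)
    {A : Set DyadicNode} (hA : IsSegment A) {w : DyadicNode} (hw : w ∈ A) :
    segSum x (upe A w) = x w + segSum x (up A w) := by
  rw [← segSum_singleton x w]
  refine segSum_union (summable_singleton x w) (seg_summable hx hpos (hA.up w)) ?_ ?_
  · rw [Set.disjoint_singleton_left]
    exact fun h => h.2.2 rfl
  · intro e _
    constructor
    · intro h
      by_cases he : e = w
      · exact Or.inl he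
      · exact Or.inr ⟨h.1, h.2, he⟩
    · rintro (h | h)
      · rw [Set.mem_singleton_iff] at h
        subst h; exact ⟨hw, List.prefix_refl _⟩
      · exact ⟨h.1, h.2.1⟩

/-- If `w` is a shortest support node of the segment `A` strictly above `d`, the sum over the
part above `d` is the sum over the part starting at `w`. -/
theorem segSum_up_eq {x : DyadicNode → ℝ} {A : Set DyadicNode} (hA : IsSegment A)
    {d w : DyadicNode} (hw : w ∈ up A d)
    (hmin : ∀ e ∈ up A d, x e ≠ 0 → w.length ≤ e.length) :
    segSum x (up A d) = segSum x (upe A w) := by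
  refine segSum_congr fun e he => ⟨fun h => ⟨h.1, ?_⟩, fun h => ⟨h.1, hw.2.1.trans h.2, ?_⟩⟩
  · rcases hA.1 e h.1 w hw.1 with h' | h'
    · rw [h'.eq_of_length_le (hmin e h he)]
    · exact h'
  · rintro rfl
    exact hw.2.2 (pfx_antisymm h.2 hw.2.1)

theorem NF.greedy {x : DyadicNode → ℝ} (hx : HasBddNorm x) (hpos : ∀ a, 0 ≤ x a)
    {ι : Type} {S : ι → Set DyadicNode} (hS : NF x S) (t : DyadicNode) (n : ℕ) :
    ∀ (i : ι) (d u : DyadicNode), d ∈ S i → u ∈ S i → u <+: d → x u ≠ 0 →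
      t.length - d.length = n → segSum x (up (pre t) d) ≤ segSum x (up (S i) d) := by
  induction n using Nat.strong_induction_on with
  | _ n ih =>
    intro i d u hd hu hud hxu hn
    by_cases hsup : ∃ e ∈ up (pre t) d, x e ≠ 0
    swap
    · push Not at hsup
      rw [segSum_zero hsup]
      exact segSum_nonneg hpos _
    obtain ⟨w, ⟨hw, hxw⟩, hmin⟩ :=
      exists_min_len (A := {e | e ∈ up (pre t) d ∧ x e ≠ 0}) hsup
    have hpre := isSegment_pre t
    have e1 : segSum x (up (pre t) d) = x w + segSum x (up (pre t) w) := by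
      rw [segSum_up_eq hpre hw (fun e h1 h2 => hmin e ⟨h1, h2⟩), segSum_upe hx hpos hpre hw.1]
    obtain ⟨j, hj⟩ := hS.cover hx hxw
    have hlt := pfx_len_lt hw.2.1 hw.2.2
    have hle : w.length ≤ t.length := List.IsPrefix.length_le hw.1
    have h2 := ih (t.length - w.length) (by omega) j w w hj hj (List.prefix_refl _) hxw rfl
    have e2 := segSum_upe hx hpos (hS.seg j) hj
    have h3 : segSum x (up (pre t) d) ≤ segSum x (upe (S j) w) := by rw [e1, e2]; linarith
    refine h3.trans ?_
    by_cases hij : i = j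
    · subst hij
      refine segSum_mono hpos (seg_summable hx hpos ((hS.seg i).up d)) fun e he =>
        ⟨he.1, hw.2.1.trans he.2, ?_⟩
      rintro rfl
      exact hw.2.2 (pfx_antisymm he.2 hw.2.1)
    · have hz : ∀ e ∈ OI d w, x e = 0 := by
        intro e he
        by_contra hxe
        have := hmin e ⟨⟨he.2.2.1.trans hw.1, he.1, he.2.1⟩, hxe⟩
        exact he.2.2.2 (he.2.2.1.eq_of_length_le this)
      have hex := (hS.exch hx hpos hij hd hj hw.2.1 hz).1
      have hpos' : 0 < segSum x (dn (S i) d) :=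
        lt_of_lt_of_le (lt_of_le_of_ne (hpos u) (Ne.symm hxu))
          (le_segSum hpos (seg_summable hx hpos ((hS.seg i).dn d)) ⟨hu, hud⟩)
      exact le_of_mul_le_mul_left hex hpos'

theorem NF.greedy_seg {x : DyadicNode → ℝ} (hx : HasBddNorm x) (hpos : ∀ a, 0 ≤ x a)
    {ι : Type} {S : ι → Set DyadicNode} (hS : NF x S) {i : ι} {d u : DyadicNode} (hd : d ∈ S i)
    (hu : u ∈ S i) (hud : u <+: d) (hxu : x u ≠ 0) {A : Set DyadicNode} (hA : IsSegment A) :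
    segSum x (up A d) ≤ segSum x (up (S i) d) := by
  have hsm := seg_summable hx hpos (hA.up d)
  refine le_of_tendsto (tendsto_fs hsm) (Eventually.of_forall fun n => ?_)
  rw [← fs_eq]
  by_cases hne : (up A d ∩ ↑(ball n)).Nonempty
  swap
  · rw [Set.not_nonempty_iff_eq_empty.1 hne, segSum_empty]
    exact segSum_nonneg hpos _
  obtain ⟨t, ht, hmax⟩ : ∃ t ∈ up A d ∩ ↑(ball n), ∀ e ∈ up A d ∩ ↑(ball n), e <+: t := by
    have hfin : (up A d ∩ ↑(ball n)).Finite := (ball n).finite_toSet.inter_of_right _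
    obtain ⟨t, ht, hmax⟩ := Set.exists_max_image _ List.length hfin hne
    refine ⟨t, ht, fun e he => ?_⟩
    rcases hA.1 e he.1.1 t ht.1.1 with h | h
    · exact h
    · rw [h.eq_of_length_le (hmax e he)]
  refine le_trans ?_ (hS.greedy hx hpos t _ i d u hd hu hud hxu rfl)
  exact segSum_mono hpos (seg_summable hx hpos ((isSegment_pre t).up d))
    fun e he => ⟨hmax e he, he.1.2.1, he.1.2.2⟩

theorem ran_complete (x : DyadicNode → ℝ) : IsCompleteSubtree (ran x) := by
  intro a ha b hb c h1 h2 K hK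
  exact hK.1 a (ha K hK) b (hb K hK) c h1 h2

theorem support_ran (x : DyadicNode → ℝ) : Function.support x ⊆ ran x :=
  fun _ ha _ hK => hK.2 ha

theorem ran_above {x : DyadicNode → ℝ} {c : DyadicNode} (hc : c ∈ ran x) :
    ∃ g, x g ≠ 0 ∧ c <+: g := by
  refine hc {c | ∃ g, x g ≠ 0 ∧ c <+: g} ⟨?_, fun a ha => ⟨a, ha, List.prefix_refl _⟩⟩
  rintro a _ b ⟨g, hg, hbg⟩ c _ h2
  exact ⟨g, hg, h2.trans hbg⟩

theorem fs_union {f : DyadicNode → ℝ} {n : ℕ} {A B C : Set DyadicNode} (hd : Disjoint A B)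
    (h : C = A ∪ B) : fs f n C = fs f n A + fs f n B := by
  subst h
  rw [fs, fs, fs, ← Finset.sum_add_distrib]
  refine Finset.sum_congr rfl fun a _ => ?_
  exact congrFun (Set.indicator_union_of_disjoint hd f) a

theorem fs_singleton (f : DyadicNode → ℝ) (a : DyadicNode) :
    Tendsto (fun n => fs f n {a}) atTop (𝓝 (f a)) := by
  have := tendsto_fs (summable_singleton f a)
  rwa [segSum_singleton] at this

theorem Null.eq_zero {f : DyadicNode → ℝ} {a : DyadicNode} (h : Null f {a}) : f a = 0 :=
  tendsto_nhds_unique (fs_singleton f a) h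

theorem Null.diff {f : DyadicNode → ℝ} {a : DyadicNode} {B C : Set DyadicNode}
    (hB : Null f B) (hC : Null f C) (ha : a ∉ B) (h : C = {a} ∪ B) : f a = 0 := by
  refine Null.eq_zero (a := a) ?_
  have h1 : ∀ n, fs f n {a} = fs f n C - fs f n B := by
    intro n
    rw [fs_union (A := {a}) (B := B) (by simpa using ha) h]; ring
  unfold Null
  simp only [h1]
  simpa using Tendsto.sub hC hB

theorem zero_off_ran {x f : DyadicNode → ℝ} (hx : HasBddNorm x)
    (H : ∀ (ι : Type) (S : ι → Set DyadicNode), NF x S → ∀ i, Null f (S i))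
    {ι : Type} {S : ι → Set DyadicNode} (hS : NF x S) {a : DyadicNode} (ha : a ∉ ran x) :
    f a = 0 := by
  have h1 : NF x (fun i => S i ∩ ran x) := by
    refine hS.of_eq (fun i => (hS.seg i).inter (ran_complete x))
      (fun i j hij => (hS.dis i j hij).mono Set.inter_subset_left Set.inter_subset_left) ?_
    intro i
    exact segSum_congr fun e he => ⟨fun h => h.1, fun h => ⟨h, support_ran x he⟩⟩
  have h2 := (h1.add hx a (fun i h => ha h.2)).2
  exact Null.eq_zero (H _ _ h2 none)

theorem null_up {x f : DyadicNode → ℝ} (hx : HasBddNorm x) (hpos : ∀ a, 0 ≤ x a)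
    (hsep : Separated x)
    (H : ∀ (ι : Type) (S : ι → Set DyadicNode), NF x S → ∀ i, Null f (S i))
    {ι : Type} {S : ι → Set DyadicNode} (hS : NF x S) {i : ι} {β : DyadicNode} (hβ : β ∈ S i) :
    Null f (up (S i) β) := by
  by_cases hz : ∀ e ∈ dn (S i) β, x e = 0
  · obtain ⟨S', hS', he⟩ := hS.shrink i ((hS.seg i).up β) (fun _ h => h.1) (by
      refine segSum_congr fun e he => ⟨fun h => h.1, fun h => ⟨h, ?_, ?_⟩⟩
      · exact ((hS.seg i).1 β hβ e h).resolve_right fun h' => he (hz e ⟨h, h'⟩)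
      · rintro rfl; exact he (hz e ⟨h, List.prefix_refl _⟩))
    rw [← he]
    exact H _ _ hS' i
  by_cases hr : ∀ c ∈ up (S i) β, c ∉ ran x
  · have h0 : ∀ n, fs f n (up (S i) β) = 0 := by
      intro n
      refine Finset.sum_eq_zero fun a _ => ?_
      by_cases ha : a ∈ up (S i) β
      · rw [Set.indicator_of_mem ha]; exact zero_off_ran hx H hS (hr a ha)
      · exact Set.indicator_of_notMem ha f
    unfold Null
    simp only [h0]
    exact tendsto_const_nhds
  push Not at hz hr
  obtain ⟨c, hc, hcr⟩ := hr
  -- the last support node below `β` in the segment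
  obtain ⟨u, ⟨hu, hxu⟩, humax⟩ := exists_max_len (A := {e | e ∈ dn (S i) β ∧ x e ≠ 0}) (t := β)
    hz (fun e he => he.1.2)
  have hβr : β ∈ ran x := ran_complete x u (support_ran x hxu) c hcr β hu.2 hc.2.1
  obtain ⟨c1, hβc1, hne, hc1c, hchild⟩ : ∃ c1, β <+: c1 ∧ c1 ≠ β ∧ c1 <+: c ∧
      ∀ e, e <+: c1 → e = c1 ∨ e <+: β := by
    obtain ⟨l, hl⟩ := hc.2.1
    cases l with
    | nil => exact (hc.2.2 (by simpa using hl.symm)).elim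
    | cons b l =>
      refine ⟨β ++ [b], List.prefix_append _ _, by simp, ⟨l, by simpa using hl⟩, fun e he => ?_⟩
      exact List.prefix_concat_iff.1 he
  have hc1S : c1 ∈ S i := (hS.seg i).2 β hβ c hc.1 c1 hβc1 hc1c
  have hc1r : c1 ∈ ran x := ran_complete x β hβr c hcr c1 hβc1 hc1c
  obtain ⟨P, hP, A1, hA1, A2, hA2, hA12, hβA1, hc1A2⟩ := hsep β hβr c1 hc1r hne.symm
  have hQ := NF.of_norming hP
  obtain ⟨V, hV⟩ := hQ.cover hx hxu
  have hVseg : IsSegment (V : Set DyadicNode) := hQ.seg V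
  have hVc1 : c1 ∉ (V : Set DyadicNode) := by
    intro h
    have h1 : β ∈ (V : Set DyadicNode) := hVseg.2 u hV c1 h β hu.2 hβc1
    have e1 : (⟨A1, hA1⟩ : P) = V := by
      by_contra hne'
      exact Set.disjoint_left.1 (hQ.dis _ _ hne') hβA1 h1
    have e2 : (⟨A2, hA2⟩ : P) = V := by
      by_contra hne'
      exact Set.disjoint_left.1 (hQ.dis _ _ hne') hc1A2 h
    exact hA12 (congrArg Subtype.val (e1.trans e2.symm))
  -- the exit node
  obtain ⟨d, ⟨hdV, hud, hdβ⟩, hdmax⟩ := exists_max_len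
    (A := {e | e ∈ (V : Set DyadicNode) ∧ u <+: e ∧ e <+: β}) (t := β)
    ⟨u, hV, List.prefix_refl _, hu.2⟩ (fun e he => he.2.2)
  have hexit : ∀ e ∈ (V : Set DyadicNode), d <+: e → e ≠ d → e <+: c1 → False := by
    intro e he hde hed hec
    rcases hchild e hec with h | h
    · subst h; exact hVc1 he
    · have := hdmax e ⟨he, hud.trans hde, h⟩
      exact hed (hde.eq_of_length_le this).symm
  have hdS : d ∈ S i := (hS.seg i).2 u hu.1 β hβ d hud hdβ
  have hdc1 : d <+: c1 := hdβ.trans hβc1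
  have hdc1' : c1 ≠ d := by
    rintro rfl; exact hVc1 hdV
  have g1 : segSum x (up (S i) d) ≤ segSum x (up (V : Set DyadicNode) d) :=
    hQ.greedy_seg hx hpos hdV hV hud hxu (hS.seg i)
  -- there is a support node above
  obtain ⟨g, hxg, hc1g⟩ := ran_above hc1r
  have g2 : 0 < segSum x (up (V : Set DyadicNode) d) := by
    have h1 : segSum x (up (pre g) d) ≤ segSum x (up (V : Set DyadicNode) d) :=
      hQ.greedy_seg hx hpos hdV hV hud hxu (isSegment_pre g)
    have h2 : x g ≤ segSum x (up (pre g) d) := by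
      refine le_segSum hpos (seg_summable hx hpos ((isSegment_pre g).up d))
        ⟨List.prefix_refl _, hdc1.trans hc1g, ?_⟩
      rintro rfl
      exact hdc1' (pfx_antisymm hc1g hdc1)
    have h3 : 0 < x g := lt_of_le_of_ne (hpos g) (Ne.symm hxg)
    linarith
  obtain ⟨w, ⟨hw, hxw⟩, hwmin⟩ :=
    exists_min_len (A := {e | e ∈ up (V : Set DyadicNode) d ∧ x e ≠ 0}) (by
      by_contra hemp
      rw [Set.not_nonempty_iff_eq_empty] at hemp
      refine g2.ne' (segSum_zero fun e he => ?_)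
      by_contra hxe
      exact (Set.eq_empty_iff_forall_notMem.1 hemp) e ⟨he, hxe⟩)
  have hsplit : ∀ e, d <+: e → e ≠ d → e <+: w → e <+: c1 → False := fun e h1 h2 h3 h4 =>
    hexit e (hVseg.2 d hdV w hw.1 e h1 h3) h1 h2 h4
  have hnc1w : ¬ c1 <+: w := fun h => hsplit c1 hdc1 hdc1' h (List.prefix_refl _)
  obtain ⟨j, hj⟩ := hS.cover hx hxw
  have hij : i ≠ j := by
    rintro rfl
    rcases (hS.seg i).1 w hj c1 hc1S with h | h
    · exact hsplit w hw.2.1 hw.2.2 (List.prefix_refl _) h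
    · exact hnc1w h
  have hz : ∀ e ∈ OI d w, x e = 0 := by
    intro e he
    by_contra hxe
    have := hwmin e ⟨⟨hVseg.2 d hdV w hw.1 e he.1 he.2.2.1, he.1, he.2.1⟩, hxe⟩
    exact he.2.2.2 (he.2.2.1.eq_of_length_le this)
  have g3 : segSum x (up (V : Set DyadicNode) d) ≤ segSum x (upe (S j) w) := by
    rw [segSum_up_eq hVseg hw (fun e h1 h2 => hwmin e ⟨h1, h2⟩), segSum_upe hx hpos hVseg hw.1,
      segSum_upe hx hpos (hS.seg j) hj]
    have := hS.greedy_seg hx hpos hj hj (List.prefix_refl _) hxw hVseg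
    linarith
  obtain ⟨F, hF, hFj⟩ := (hS.exch hx hpos hij hdS hj hw.2.1 hz).2 (g1.trans g3)
  have hsub : ∀ e ∈ up (S i) d, e ∉ OI d w := by
    intro e he ho
    rcases (hS.seg i).1 e he.1 c1 hc1S with h | h
    · exact hsplit e ho.1 ho.2.1 ho.2.2.1 h
    · exact hnc1w (h.trans ho.2.2.1)
  have hFj' : F j = up (S i) d := by
    rw [hFj]
    ext e
    exact ⟨fun h => h.1, fun h => ⟨h, hsub e h⟩⟩
  obtain ⟨S', hS', he⟩ := hF.shrink j ((hS.seg i).up β) (by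
      rw [hFj']
      intro e he
      refine ⟨he.1, hdβ.trans he.2.1, ?_⟩
      rintro rfl
      exact he.2.2 (pfx_antisymm hdβ he.2.1)) (by
      rw [hFj']
      refine segSum_congr fun e he => ⟨fun h => ⟨h.1, hdβ.trans h.2.1, ?_⟩, fun h => ?_⟩
      · rintro rfl
        exact h.2.2 (pfx_antisymm hdβ h.2.1)
      · have hnot : ¬ e <+: β := by
          intro heβ
          have h5 := humax e ⟨⟨h.1, heβ⟩, he⟩
          have h6 := pfx_len_lt h.2.1 h.2.2
          have h7 := hud.length_le
          omega
        refine ⟨h.1, ((hS.seg i).1 e h.1 β hβ).resolve_left hnot, ?_⟩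
        rintro rfl
        exact hnot (List.prefix_refl _))
  rw [← he]
  exact H _ _ hS' j

theorem sep_zero {x f : DyadicNode → ℝ} (hx : HasBddNorm x) (hpos : ∀ a, 0 ≤ x a)
    (hsep : Separated x)
    (H : ∀ (ι : Type) (S : ι → Set DyadicNode), NF x S → ∀ i, Null f (S i))
    {ι : Type} {S : ι → Set DyadicNode} (hS : NF x S) : f = 0 := by
  funext β
  by_cases hcov : ∀ i, β ∉ S i
  · exact Null.eq_zero (H _ _ (hS.add hx β hcov).2 none)
  push Not at hcov
  obtain ⟨i, hi⟩ := hcov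
  have hup := null_up hx hpos hsep H hS hi
  have hnot : β ∉ up (S i) β := fun h => h.2.2 rfl
  by_cases hmin : ∀ e ∈ S i, β <+: e
  · refine Null.diff hup (H _ _ hS i) hnot ?_
    ext e
    constructor
    · intro he
      by_cases h : e = β
      · exact Or.inl h
      · exact Or.inr ⟨he, hmin e he, h⟩
    · rintro (h | h)
      · rw [Set.mem_singleton_iff] at h; subst h; exact hi
      · exact h.1
  push Not at hmin
  obtain ⟨e, he, hβe⟩ := hmin
  have heβ : e <+: β := ((hS.seg i).1 e he β hi).resolve_right hβe
  obtain ⟨p, hpβ, hpne, hpc⟩ : ∃ p, p <+: β ∧ β ≠ p ∧ ∀ e, e <+: β → e = β ∨ e <+: p := by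
    rcases List.eq_nil_or_concat' β with h | ⟨p, b, h⟩
    · subst h
      exact (hβe (List.nil_prefix)).elim
    · subst h
      exact ⟨p, List.prefix_append _ _, by simp, fun e he => List.prefix_concat_iff.1 he⟩
  have hep : e <+: p := (hpc e heβ).resolve_left (by rintro rfl; exact hβe (List.prefix_refl _))
  have hpS : p ∈ S i := (hS.seg i).2 e he β hi p hep hpβ
  refine Null.diff hup (null_up hx hpos hsep H hS hpS) hnot ?_
  ext a
  constructor
  · intro ha
    by_cases h : a = β
    · exact Or.inl h
    · refine Or.inr ⟨ha.1, ?_, h⟩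
      rcases (hS.seg i).1 a ha.1 β hi with h' | h'
      · exact (ha.2.2 (pfx_antisymm ((hpc a h').resolve_left h) ha.2.1)).elim
      · exact h'
  · rintro (h | h)
    · rw [Set.mem_singleton_iff] at h; subst h; exact ⟨hi, hpβ, hpne⟩
    · refine ⟨h.1, hpβ.trans h.2.1, ?_⟩
      rintro rfl
      exact h.2.2 (pfx_antisymm hpβ h.2.1)

/-- relations describing full partitions of the tree into segments -/
structure GR (r : DyadicNode → DyadicNode → Prop) : Prop where
  refl : ∀ a, r a a
  symm : ∀ a b, r a b → r b a
  trans : ∀ a b c, r a b → r b c → r a c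
  cmp : ∀ a b, r a b → a <+: b ∨ b <+: a
  conv : ∀ a b c, r a b → a <+: c → c <+: b → r a c

/-- the set of classes -/
def cl (r : DyadicNode → DyadicNode → Prop) : Set (Set DyadicNode) :=
  Set.range (fun a => {b | r a b})

theorem GR.cl_eq {r : DyadicNode → DyadicNode → Prop} (h : GR r) {A : Set DyadicNode}
    (hA : A ∈ cl r) {a : DyadicNode} (ha : a ∈ A) : A = {b | r a b} := by
  obtain ⟨c, rfl⟩ := hA
  ext b
  exact ⟨fun hb => h.trans a c b (h.symm _ _ ha) hb, fun hb => h.trans c a b ha hb⟩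

theorem GR.part {r : DyadicNode → DyadicNode → Prop} (h : GR r) : IsPartition (cl r) := by
  constructor
  · intro A hA
    constructor
    · intro a ha b hb
      rw [h.cl_eq hA ha] at hb
      exact h.cmp a b hb
    · intro a ha b hb c h1 h2
      rw [h.cl_eq hA ha] at hb ⊢
      exact h.conv a b c hb h1 h2
  · intro A hA B hB hAB
    rw [Function.onFun, id, id, Set.disjoint_left]
    intro a ha hb
    exact hAB ((h.cl_eq hA ha).trans (h.cl_eq hB hb).symm)

/-- relation of a partition -/
def rel (P : Set (Set DyadicNode)) (a b : DyadicNode) : Prop := a = b ∨ ∃ A ∈ P, a ∈ A ∧ b ∈ A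

theorem part_unique {P : Set (Set DyadicNode)} (hP : IsPartition P) {A B : Set DyadicNode}
    (hA : A ∈ P) (hB : B ∈ P) {a : DyadicNode} (ha : a ∈ A) (hb : a ∈ B) : A = B := by
  by_contra hne
  exact Set.disjoint_left.1 (hP.2 hA hB hne) ha hb

theorem gr_rel {P : Set (Set DyadicNode)} (hP : IsPartition P) : GR (rel P) := by
  refine ⟨fun a => Or.inl rfl, ?_, ?_, ?_, ?_⟩
  · rintro a b (h | ⟨A, hA, h1, h2⟩)
    · exact Or.inl h.symm
    · exact Or.inr ⟨A, hA, h2, h1⟩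
  · rintro a b c (rfl | ⟨A, hA, h1, h2⟩) (rfl | ⟨B, hB, h3, h4⟩)
    · exact Or.inl rfl
    · exact Or.inr ⟨B, hB, h3, h4⟩
    · exact Or.inr ⟨A, hA, h1, h2⟩
    · have := part_unique hP hA hB h2 h3
      subst this
      exact Or.inr ⟨A, hA, h1, h4⟩
  · rintro a b (rfl | ⟨A, hA, h1, h2⟩)
    · exact Or.inl (List.prefix_refl _)
    · exact (hP.1 A hA).1 a h1 b h2
  · rintro a b c (rfl | ⟨A, hA, h1, h2⟩) h3 h4
    · exact Or.inl (pfx_antisymm h3 h4)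
    · exact Or.inr ⟨A, hA, h1, (hP.1 A hA).2 a h1 b h2 c h3 h4⟩

theorem part_summable {y : DyadicNode → ℝ} (hy : HasBddNorm y) {P : Set (Set DyadicNode)}
    (hP : IsPartition P) : Summable (fun A : P => segSum y A ^ 2) :=
  fam_summable hy (S := fun A : P => (A : Set DyadicNode)) (fun A => hP.1 A A.2) hP.disj

theorem pNormSq_le {y : DyadicNode → ℝ} (hy : HasBddNorm y) {P : Set (Set DyadicNode)}
    (hP : IsPartition P) : pNormSq y P ≤ JTnormSq y := le_csSup hy ⟨P, hP, rfl⟩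

theorem pNormSq_le_cl {x : DyadicNode → ℝ} (hx : HasBddNorm x) {P : Set (Set DyadicNode)}
    (hP : IsPartition P) : pNormSq x P ≤ pNormSq x (cl (rel P)) := by
  classical
  have h1 := part_summable hx hP
  have h2 := part_summable hx (gr_rel hP).part
  have e1 : pNormSq x P = ∑' A, P.indicator (fun A => segSum x A ^ 2) A :=
    tsum_subtype P (fun A => segSum x A ^ 2)
  have e2 : pNormSq x (cl (rel P)) = ∑' A, (cl (rel P)).indicator (fun A => segSum x A ^ 2) A :=
    tsum_subtype _ (fun A => segSum x A ^ 2)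
  rw [e1, e2]
  refine (summable_subtype_iff_indicator.1 h1).tsum_le_tsum ?_
    (summable_subtype_iff_indicator.1 h2)
  intro A
  by_cases hA : A ∈ P
  swap
  · rw [Set.indicator_of_notMem hA]
    exact Set.indicator_nonneg (fun _ _ => sq_nonneg _) _
  rcases A.eq_empty_or_nonempty with h | ⟨a, ha⟩
  · subst h
    simp [Set.indicator, segSum_empty]
  · have : A ∈ cl (rel P) := by
      refine ⟨a, ?_⟩
      ext b
      constructor
      · rintro (h | ⟨B, hB, h1, h2⟩)
        · rwa [← h]
        · rwa [part_unique hP hA hB ha h1]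
      · exact fun hb => Or.inr ⟨A, hA, ha, hb⟩
    rw [Set.indicator_of_mem hA, Set.indicator_of_mem this]

theorem finsupp_summable {y : DyadicNode → ℝ} {F : Finset DyadicNode} (hF : ∀ a, a ∉ F → y a = 0)
    (A : Set DyadicNode) : Summable (A.indicator y) := by
  apply summable_of_ne_finset_zero (s := F)
  intro a ha
  simp [Set.indicator, hF a ha]

theorem finsupp_segSum {y : DyadicNode → ℝ} {F : Finset DyadicNode} (hF : ∀ a, a ∉ F → y a = 0)
    (A : Set DyadicNode) : segSum y A = ∑ a ∈ F, A.indicator y a := by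
  rw [segSum_eq]
  apply tsum_eq_sum
  intro a ha
  simp [Set.indicator, hF a ha]

theorem finsupp_hasSum {y : DyadicNode → ℝ} {F : Finset DyadicNode} (hF : ∀ a, a ∉ F → y a = 0)
    {r : DyadicNode → DyadicNode → Prop} (h : GR r) :
    HasSum (fun A : cl r => segSum y A ^ 2) (∑ a ∈ F, y a * segSum y {b | r a b}) := by
  classical
  have e : ∀ A : cl r, segSum y A ^ 2
      = ∑ a ∈ F, (if a ∈ (A : Set DyadicNode) then y a * segSum y {b | r a b} else 0) := by
    intro A
    rw [sq]
    nth_rewrite 1 [finsupp_segSum hF]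
    rw [Finset.sum_mul]
    refine Finset.sum_congr rfl fun a _ => ?_
    by_cases ha : a ∈ (A : Set DyadicNode)
    · rw [← h.cl_eq A.2 ha]; simp [ha]
    · simp [ha]
  simp only [e]
  refine hasSum_sum fun a _ => ?_
  have := hasSum_single (f := fun A : cl r =>
    (if a ∈ (A : Set DyadicNode) then y a * segSum y {b | r a b} else 0))
    (⟨{b | r a b}, a, rfl⟩ : cl r) (by
      intro A hA
      refine if_neg fun ha => hA (Subtype.ext (h.cl_eq A.2 ha)))
  simpa [h.refl a] using this

theorem finsupp_agree {y : DyadicNode → ℝ} {F : Finset DyadicNode} (hF : ∀ a, a ∉ F → y a = 0)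
    {r r' : DyadicNode → DyadicNode → Prop} (h : GR r) (h' : GR r')
    (hag : ∀ a ∈ F, ∀ b ∈ F, (r a b ↔ r' a b)) : pNormSq y (cl r) = pNormSq y (cl r') := by
  classical
  unfold pNormSq
  rw [(finsupp_hasSum hF h).tsum_eq, (finsupp_hasSum hF h').tsum_eq]
  refine Finset.sum_congr rfl fun a ha => ?_
  rw [finsupp_segSum hF, finsupp_segSum hF]
  congr 1
  refine Finset.sum_congr rfl fun b hb => ?_
  simp [Set.indicator, hag a ha b hb]

theorem sq_add_le {η u v : ℝ} (hη : 0 < η) :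
    (u + v) ^ 2 ≤ (1 + η) * u ^ 2 + (1 + η⁻¹) * v ^ 2 := by
  have h : 0 ≤ η * (u - η⁻¹ * v) ^ 2 := by positivity
  have e : η * (u - η⁻¹ * v) ^ 2 = η * u ^ 2 - 2 * (u * v) + η⁻¹ * v ^ 2 := by
    field_simp
    ring
  nlinarith

theorem pNormSq_add_le {P : Set (Set DyadicNode)} {x y z : DyadicNode → ℝ} {η ρ : ℝ} (hη : 0 < η)
    (hadd : ∀ A ∈ P, segSum x A = segSum y A + segSum z A)
    (hys : Summable (fun A : P => segSum y A ^ 2))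
    (hzs : Summable (fun A : P => segSum z A ^ 2)) (hz : pNormSq z P ≤ ρ) :
    pNormSq x P ≤ (1 + η) * pNormSq y P + (1 + η⁻¹) * ρ := by
  have hle : ∀ A : P, segSum x A ^ 2 ≤ (1 + η) * segSum y A ^ 2 + (1 + η⁻¹) * segSum z A ^ 2 := by
    intro A
    rw [hadd A A.2]
    exact sq_add_le hη
  have hs := (hys.mul_left (1 + η)).add (hzs.mul_left (1 + η⁻¹))
  have h1 : pNormSq x P ≤ ∑' A : P, ((1 + η) * segSum y A ^ 2 + (1 + η⁻¹) * segSum z A ^ 2) :=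
    (Summable.of_nonneg_of_le (fun _ => sq_nonneg _) hle hs).tsum_le_tsum hle hs
  rw [(hys.mul_left (1 + η)).tsum_add (hzs.mul_left (1 + η⁻¹)), tsum_mul_left, tsum_mul_left] at h1
  have h2 : (1 + η⁻¹) * pNormSq z P ≤ (1 + η⁻¹) * ρ := by
    apply mul_le_mul_of_nonneg_left hz
    positivity
  unfold pNormSq at *
  linarith

theorem exists_norming {x : DyadicNode → ℝ} (hx : MemJT x) (hpos : ∀ a, 0 ≤ x a)
    (E : DyadicNode → DyadicNode → Prop)
    (h : ∀ ε > 0, ∃ r, GR r ∧ JTnormSq x - ε < pNormSq x (cl r) ∧ ∀ a b, r a b → ¬ E a b) :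
    ∃ r, GR r ∧ IsNormingPartition x (cl r) ∧ ∀ a b, r a b → ¬ E a b := by
  classical
  choose! R hR using h
  let U : Ultrafilter ℕ := hyperfilter ℕ
  let Rn : ℕ → DyadicNode → DyadicNode → Prop := fun n => R (1 / ((n : ℝ) + 1))
  have hRn : ∀ n, GR (Rn n) ∧ JTnormSq x - 1 / ((n : ℝ) + 1) < pNormSq x (cl (Rn n)) ∧
      ∀ a b, Rn n a b → ¬ E a b := fun n => hR _ (by positivity)
  let r : DyadicNode → DyadicNode → Prop := fun a b => ∀ᶠ n in U, Rn n a b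
  have hr : GR r := by
    refine ⟨fun a => Eventually.of_forall fun n => (hRn n).1.refl a, ?_, ?_, ?_, ?_⟩
    · intro a b hab
      exact hab.mono fun n hn => (hRn n).1.symm _ _ hn
    · intro a b c hab hbc
      filter_upwards [hab, hbc] with n h1 h2 using (hRn n).1.trans _ _ _ h1 h2
    · intro a b hab
      obtain ⟨n, hn⟩ := Eventually.exists hab
      exact (hRn n).1.cmp _ _ hn
    · intro a b c hab h1 h2
      exact hab.mono fun n hn => (hRn n).1.conv _ _ _ hn h1 h2
  refine ⟨r, hr, ⟨hr.part, le_antisymm (pNormSq_le hx.1 hr.part) ?_⟩, ?_⟩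
  swap
  · intro a b hab
    obtain ⟨n, hn⟩ := Eventually.exists hab
    exact (hRn n).2.2 _ _ hn
  have key : ∀ η > 0, JTnormSq x ≤ (1 + η) * ((1 + η) * pNormSq x (cl r) + (1 + η⁻¹) * η ^ 2)
      + (1 + η⁻¹) * η ^ 2 + η := by
    intro η hη
    obtain ⟨y, hyf, hyb, hyn⟩ := hx.2 η hη
    have hρ : JTnormSq (x - y) ≤ η ^ 2 := by
      have := Real.sqrt_le_left hη.le |>.1 hyn
      exact this
    set F := hyf.toFinset with hFdef
    have hF : ∀ a, a ∉ F → y a = 0 := by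
      intro a ha
      simpa [hFdef] using ha
    have hagree : ∀ᶠ n in U, ∀ a ∈ F, ∀ b ∈ F, (Rn n a b ↔ r a b) := by
      rw [Filter.eventually_all_finset]
      intro a _
      rw [Filter.eventually_all_finset]
      intro b _
      by_cases hab : r a b
      · filter_upwards [hab] with n hn
        simp [hn, hab]
      · have : ∀ᶠ n in U, ¬ Rn n a b := Ultrafilter.eventually_not.2 hab
        filter_upwards [this] with n hn
        simp [hn, hab]
    have hsmall : ∀ᶠ n : ℕ in U, 1 / ((n : ℝ) + 1) < η := by
      have h1 : ∀ᶠ n : ℕ in atTop, 1 / ((n : ℝ) + 1) < η :=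
        tendsto_one_div_add_atTop_nhds_zero_nat.eventually (gt_mem_nhds hη)
      exact Nat.hyperfilter_le_atTop h1
    obtain ⟨n, hn1, hn2⟩ := (hagree.and hsmall).exists
    have hgn := (hRn n).1
    have hq := finsupp_agree hF hgn hr hn1
    have sx : ∀ {A : Set DyadicNode}, IsSegment A → Summable (A.indicator x) := fun hA =>
      seg_summable hx.1 hpos hA
    have hsub : ∀ {A : Set DyadicNode}, IsSegment A →
        segSum (x - y) A = segSum x A - segSum y A := by
      intro A hA
      rw [segSum_eq, segSum_eq, segSum_eq, ← (sx hA).tsum_sub (finsupp_summable hF A)]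
      congr 1
      ext a
      by_cases ha : a ∈ A <;> simp [ha]
    have hsub' : ∀ {A : Set DyadicNode}, IsSegment A →
        segSum (y - x) A = segSum y A - segSum x A := by
      intro A hA
      rw [segSum_eq, segSum_eq, segSum_eq, ← (finsupp_summable hF A).tsum_sub (sx hA)]
      congr 1
      ext a
      by_cases ha : a ∈ A <;> simp [ha]
    have b1 : pNormSq x (cl (Rn n)) ≤ (1 + η) * pNormSq y (cl (Rn n)) + (1 + η⁻¹) * η ^ 2 := by
      refine pNormSq_add_le (z := x - y) hη ?_ (finsupp_hasSum hF hgn).summable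
        (part_summable hyb hgn.part) ((pNormSq_le hyb hgn.part).trans hρ)
      intro A hA
      rw [hsub (hgn.part.1 A hA)]; ring
    have hsq : ∀ A : cl r, segSum (y - x) A ^ 2 = segSum (x - y) A ^ 2 := by
      intro A
      rw [hsub (hr.part.1 A A.2), hsub' (hr.part.1 A A.2)]; ring
    have b2 : pNormSq y (cl r) ≤ (1 + η) * pNormSq x (cl r) + (1 + η⁻¹) * η ^ 2 := by
      refine pNormSq_add_le (z := y - x) hη ?_ (part_summable hx.1 hr.part) ?_ ?_
      · intro A hA
        rw [hsub' (hr.part.1 A hA)]; ring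
      · simp only [hsq]
        exact part_summable hyb hr.part
      · have : pNormSq (y - x) (cl r) = pNormSq (x - y) (cl r) := tsum_congr hsq
        rw [this]
        exact (pNormSq_le hyb hr.part).trans hρ
    have b3 := (hRn n).2.1
    have b4 : (1 + η) * pNormSq y (cl r)
        ≤ (1 + η) * ((1 + η) * pNormSq x (cl r) + (1 + η⁻¹) * η ^ 2) :=
      mul_le_mul_of_nonneg_left b2 (by linarith)
    rw [hq] at b1
    linarith
  set Q := pNormSq x (cl r)
  have hcont : Tendsto (fun η : ℝ => (1 + η) * ((1 + η) * Q + (η ^ 2 + η)) + (η ^ 2 + η) + η)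
      (𝓝[>] 0) (𝓝 Q) := by
    have : Tendsto (fun η : ℝ => (1 + η) * ((1 + η) * Q + (η ^ 2 + η)) + (η ^ 2 + η) + η)
      (𝓝 0) (𝓝 ((1 + 0) * ((1 + 0) * Q + (0 ^ 2 + 0)) + (0 ^ 2 + 0) + 0)) := by
      apply Continuous.tendsto
      fun_prop
    have h2 := this.mono_left (nhdsWithin_le_nhds (s := Set.Ioi 0))
    simpa using h2
  refine ge_of_tendsto hcont ?_
  filter_upwards [self_mem_nhdsWithin] with η hη
  have hη' : (0 : ℝ) < η := hη
  have e : (1 + η⁻¹) * η ^ 2 = η ^ 2 + η := by field_simp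
  have := key η hη'
  rwa [e] at this

theorem exists_norming' {x : DyadicNode → ℝ} (hx : MemJT x) (hpos : ∀ a, 0 ≤ x a) :
    ∃ P, IsNormingPartition x P := by
  obtain ⟨r, _, h, _⟩ := exists_norming hx hpos (fun _ _ => False) (by
    intro ε hε
    have hne : (normSqSet x).Nonempty := ⟨_, ∅, ⟨by simp, by simp⟩, rfl⟩
    obtain ⟨_, ⟨P, hP, rfl⟩, hlt⟩ :=
      exists_lt_of_lt_csSup hne (show JTnormSq x - ε < sSup (normSqSet x) by
        change _ < JTnormSq x; linarith)
    exact ⟨rel P, gr_rel hP, hlt.trans_le (pNormSq_le_cl hx.1 hP), by simp⟩)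
  exact ⟨_, h⟩

/-- gap -/
theorem exists_gap {x : DyadicNode → ℝ} (hx : MemJT x) (hpos : ∀ a, 0 ≤ x a) {α β : DyadicNode}
    (hne : α ≠ β) (hno : ¬ ∃ P, IsNormingPartition x P ∧
      ∃ S ∈ P, ∃ S' ∈ P, S ≠ S' ∧ α ∈ S ∧ β ∈ S') :
    ∃ δ > 0, ∀ P, IsPartition P → (∀ A ∈ P, α ∈ A → β ∉ A) → pNormSq x P ≤ JTnormSq x - δ := by
  by_contra hcon
  push Not at hcon
  obtain ⟨r, hr, hn, hE⟩ := exists_norming hx hpos (fun a b => a = α ∧ b = β) (by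
    intro ε hε
    obtain ⟨P, hP, h1, h2⟩ := hcon ε hε
    refine ⟨rel P, gr_rel hP, h2.trans_le (pNormSq_le_cl hx.1 hP), ?_⟩
    rintro a b hab ⟨rfl, rfl⟩
    rcases hab with h | ⟨A, hA, h3, h4⟩
    · exact hne h
    · exact h1 A hA h3 h4)
  refine hno ⟨_, hn, _, ⟨α, rfl⟩, _, ⟨β, rfl⟩, ?_, hr.refl α, hr.refl β⟩
  intro he
  have h1 : β ∈ {b | r β b} := hr.refl β
  change {b | r α b} = {b | r β b} at he
  rw [← he] at h1
  exact hE α β h1 ⟨rfl, rfl⟩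

theorem sum_ind_le {P : Set (Set DyadicNode)} (hP : IsPartition P) (a : DyadicNode)
    (s : Finset P) [DecidablePred fun A : P => a ∈ (A : Set DyadicNode)] :
    ∑ A ∈ s, (if a ∈ (A : Set DyadicNode) then (1 : ℝ) else 0) ≤ 1 := by
  rw [Finset.sum_boole]
  have : (s.filter fun A : P => a ∈ (A : Set DyadicNode)).card ≤ 1 := by
    rw [Finset.card_le_one]
    intro A hA B hB
    exact Subtype.ext (part_unique hP A.2 B.2 (Finset.mem_filter.1 hA).2 (Finset.mem_filter.1 hB).2)
  exact_mod_cast this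

/-- the perturbation -/
noncomputable def pert (α β : DyadicNode) (t : ℝ) : DyadicNode → ℝ :=
  fun a => ({α} : Set DyadicNode).indicator (fun _ => t) a
    - ({β} : Set DyadicNode).indicator (fun _ => t) a

theorem pert_zero {α β : DyadicNode} {t : ℝ} (a : DyadicNode)
    (ha : a ∉ ({α, β} : Finset DyadicNode)) : pert α β t a = 0 := by
  simp only [Finset.mem_insert, Finset.mem_singleton, not_or] at ha
  simp [pert, ha.1, ha.2]

theorem pert_segSum {α β : DyadicNode} (hne : α ≠ β) (t : ℝ) (A : Set DyadicNode)
    [Decidable (α ∈ A)] [Decidable (β ∈ A)] :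
    segSum (pert α β t) A = (if α ∈ A then t else 0) - (if β ∈ A then t else 0) := by
  rw [finsupp_segSum pert_zero, Finset.sum_pair hne]
  by_cases h1 : α ∈ A <;> by_cases h2 : β ∈ A <;> simp [h1, h2, pert, hne, hne.symm]

theorem pert_le {x : DyadicNode → ℝ} (hx : HasBddNorm x) (hpos : ∀ a, 0 ≤ x a)
    {α β : DyadicNode} (hne : α ≠ β) {δ η t : ℝ} (hη : 0 < η)
    (hgap : ∀ P, IsPartition P → (∀ A ∈ P, α ∈ A → β ∉ A) → pNormSq x P ≤ JTnormSq x - δ)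
    (h1 : (1 + η) * (JTnormSq x - δ) + (1 + η⁻¹) * (2 * t ^ 2) ≤ JTnormSq x)
    {P : Set (Set DyadicNode)} (hP : IsPartition P) :
    pNormSq (x + pert α β t) P ≤ JTnormSq x := by
  classical
  have hadd : ∀ A ∈ P, segSum (x + pert α β t) A = segSum x A + segSum (pert α β t) A := by
    intro A hA
    rw [segSum_eq, segSum_eq, segSum_eq, ← (seg_summable hx hpos (hP.1 A hA)).tsum_add
      (finsupp_summable pert_zero A)]
    congr 1
    ext a
    by_cases ha : a ∈ A <;> simp [ha]
  by_cases hsep : ∀ A ∈ P, α ∈ A → β ∉ A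
  · have hsq : ∀ A : P, segSum (pert α β t) A ^ 2
        = t ^ 2 * (if α ∈ (A : Set DyadicNode) then (1 : ℝ) else 0)
          + t ^ 2 * (if β ∈ (A : Set DyadicNode) then (1 : ℝ) else 0) := by
      intro A
      rw [pert_segSum hne]
      have := hsep A A.2
      by_cases h1 : α ∈ (A : Set DyadicNode)
      · simp [h1, this h1]
      · by_cases h2 : β ∈ (A : Set DyadicNode) <;> simp [h1, h2]
    have hsum : ∀ s : Finset P, ∑ A ∈ s, segSum (pert α β t) A ^ 2 ≤ 2 * t ^ 2 := by
      intro s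
      simp only [hsq]
      rw [Finset.sum_add_distrib, ← Finset.mul_sum, ← Finset.mul_sum]
      have := sum_ind_le hP α s
      have := sum_ind_le hP β s
      nlinarith [sq_nonneg t]
    have hs : Summable (fun A : P => segSum (pert α β t) A ^ 2) :=
      summable_of_sum_le (fun _ => sq_nonneg _) hsum
    have := pNormSq_add_le hη hadd (part_summable hx hP) hs (hs.tsum_le_of_sum_le hsum)
    have h2 := mul_le_mul_of_nonneg_left (hgap P hP hsep) (by linarith : (0 : ℝ) ≤ 1 + η)
    linarith
  · push Not at hsep
    obtain ⟨B, hB, hαB, hβB⟩ := hsep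
    have : pNormSq (x + pert α β t) P = pNormSq x P := by
      refine tsum_congr fun A => ?_
      rw [hadd A A.2, pert_segSum hne]
      have hiff : α ∈ (A : Set DyadicNode) ↔ β ∈ (A : Set DyadicNode) := by
        constructor
        · intro h; rwa [part_unique hP A.2 hB h hαB]
        · intro h; rwa [part_unique hP A.2 hB h hβB]
      simp [hiff]
    rw [this]
    exact pNormSq_le hx hP

theorem memJT_add {x f : DyadicNode → ℝ} (hx : MemJT x) (hf : (Function.support f).Finite)
    (hb : HasBddNorm (x + f)) : MemJT (x + f) := by
  refine ⟨hb, fun ε hε => ?_⟩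
  obtain ⟨y, hy, h1, h2⟩ := hx.2 ε hε
  refine ⟨y + f, (hy.union hf).subset (Function.support_add y f), ?_⟩
  rw [add_sub_add_right_eq_sub]
  exact ⟨h1, h2⟩

theorem extreme_to_sep {x : DyadicNode → ℝ} (hx : MemJT x) (hpos : ∀ a, 0 ≤ x a)
    (hext : IsExtremePoint x) : Separated x := by
  intro α _ β _ hne
  by_contra hno
  obtain ⟨δ, hδ, hgap⟩ := exists_gap hx hpos hne hno
  have hN := JTnormSq_nonneg x
  set N := JTnormSq x with hNdef
  set η := δ / (2 * (N + 1)) with hηdef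
  have hη : 0 < η := by positivity
  set κ := δ / (4 * (1 + η⁻¹)) with hκ
  have hκ0 : 0 < κ := by positivity
  set t := min 1 κ with ht
  have ht0 : 0 < t := lt_min one_pos hκ0
  have ht1 : t ≤ 1 := min_le_left _ _
  have ht2 : t ≤ κ := min_le_right _ _
  have hbound : ∀ s : ℝ, s ^ 2 = t ^ 2 →
      (1 + η) * (N - δ) + (1 + η⁻¹) * (2 * s ^ 2) ≤ N := by
    intro s hs
    rw [hs]
    have a1 : η * (N + 1) = δ / 2 := by rw [hηdef]; field_simp
    have a2 : κ * (1 + η⁻¹) = δ / 4 := by rw [hκ]; field_simp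
    have a3 : t ^ 2 ≤ κ := by nlinarith
    have a4 : 0 < 1 + η⁻¹ := by positivity
    have a5 : (1 + η⁻¹) * t ^ 2 ≤ δ / 4 := by
      rw [← a2, mul_comm κ]
      exact mul_le_mul_of_nonneg_left a3 a4.le
    nlinarith [mul_pos hη hδ]
  have hle : ∀ s : ℝ, s ^ 2 = t ^ 2 → ∀ P, IsPartition P → pNormSq (x + pert α β s) P ≤ N :=
    fun s hs P hP => pert_le hx.1 hpos hne hη hgap (hbound s hs) hP
  have hB : ∀ s : ℝ, s ^ 2 = t ^ 2 → HasBddNorm (x + pert α β s) := by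
    intro s hs
    refine ⟨N, ?_⟩
    rintro _ ⟨P, hP, rfl⟩
    exact hle s hs P hP
  have hnn : ∀ z, (normSqSet z).Nonempty := fun z => ⟨_, ∅, ⟨by simp, by simp⟩, rfl⟩
  have hJ : ∀ s : ℝ, s ^ 2 = t ^ 2 → JTnormSq (x + pert α β s) ≤ N := by
    intro s hs
    refine csSup_le (hnn _) ?_
    rintro _ ⟨P, hP, rfl⟩
    exact hle s hs P hP
  have hM : ∀ s : ℝ, s ^ 2 = t ^ 2 → MemJT (x + pert α β s) := by
    intro s hs
    refine memJT_add hx ?_ (hB s hs)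
    refine (({α, β} : Finset DyadicNode).finite_toSet).subset fun a ha => ?_
    by_contra h
    exact ha (pert_zero a h)
  have e1 : t ^ 2 = t ^ 2 := rfl
  have e2 : (-t) ^ 2 = t ^ 2 := by ring
  set y := x + pert α β t with hy
  set z := x + pert α β (-t) with hz
  have hneg : pert α β (-t) = - pert α β t := by
    funext a
    classical
    simp only [pert, Pi.neg_apply, Set.indicator, Set.mem_singleton_iff]
    split_ifs <;> ring
  have hxyz : x = (1 / 2 : ℝ) • y + (1 - 1 / 2 : ℝ) • z := by
    funext a
    simp only [hy, hz, hneg, Pi.add_apply, Pi.smul_apply, Pi.neg_apply, smul_eq_mul]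
    ring
  have hmid : N ≤ (JTnormSq y + JTnormSq z) / 2 := by
    refine csSup_le (hnn _) ?_
    rintro _ ⟨P, hP, rfl⟩
    have sy := part_summable (hB t e1) hP
    have sz := part_summable (hB (-t) e2) hP
    have hA : ∀ A : P, segSum x A ^ 2 ≤ (1 / 2) * segSum y A ^ 2 + (1 / 2) * segSum z A ^ 2 := by
      intro A
      have hsx := seg_summable hx.1 hpos (hP.1 A A.2)
      have hsp : ∀ s, segSum (x + pert α β s) A = segSum x A + segSum (pert α β s) A := by
        intro s
        rw [segSum_eq, segSum_eq, segSum_eq, ← hsx.tsum_add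
          (finsupp_summable pert_zero (A : Set DyadicNode))]
        congr 1
        ext a
        by_cases ha : a ∈ (A : Set DyadicNode) <;> simp [ha]
      have hop : segSum (pert α β (-t)) A = - segSum (pert α β t) A := by
        rw [hneg]
        unfold segSum
        simp [tsum_neg]
      rw [hy, hz, hsp, hsp, hop]
      nlinarith [sq_nonneg (segSum (pert α β t) A)]
    have hs := (sy.mul_left (1 / 2)).add (sz.mul_left (1 / 2))
    have h1 : pNormSq x P ≤ ∑' A : P, ((1 / 2) * segSum y A ^ 2 + (1 / 2) * segSum z A ^ 2) :=
      (part_summable hx.1 hP).tsum_le_tsum hA hs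
    rw [(sy.mul_left (1 / 2)).tsum_add (sz.mul_left (1 / 2)), tsum_mul_left, tsum_mul_left] at h1
    have h2 := pNormSq_le (hB t e1) hP
    have h3 := pNormSq_le (hB (-t) e2) hP
    change pNormSq x P ≤ 1 / 2 * pNormSq y P + 1 / 2 * pNormSq z P at h1
    linarith
  have hy1 : JTnormSq y ≤ N := hJ t e1
  have hz1 : JTnormSq z ≤ N := hJ (-t) e2
  have hyN : JTnormSq y = JTnormSq x := by linarith
  have hzN : JTnormSq z = JTnormSq x := by linarith
  have hfin := (hext.2 y z (hM t e1) (hM (-t) e2) (1 / 2) (by norm_num) (by norm_num) hxyz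
    (by rw [JTnorm, JTnorm, hyN]) (by rw [JTnorm, JTnorm, hzN])).1
  have h5 := congrFun hfin α
  simp [hy, pert, hne] at h5
  linarith

theorem sep_to_extreme {x : DyadicNode → ℝ} (hx : MemJT x) (hpos : ∀ a, 0 ≤ x a) (hx0 : x ≠ 0)
    (hsep : Separated x) : IsExtremePoint x := by
  refine ⟨hx0, fun y z hy hz l hl0 hl1 hxyz hny hnz => ?_⟩
  obtain ⟨P, hP⟩ := exists_norming' hx hpos
  have hy' : JTnormSq y = JTnormSq x :=
    (Real.sqrt_inj (JTnormSq_nonneg _) (JTnormSq_nonneg _)).1 hny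
  have hz' : JTnormSq z = JTnormSq x :=
    (Real.sqrt_inj (JTnormSq_nonneg _) (JTnormSq_nonneg _)).1 hnz
  have hf : y - z = 0 := sep_zero hx.1 hpos hsep
    (fun ι S hS i => hS.null hx.1 hpos hy.1 hz.1 hl0 hl1 hxyz hy' hz' i) (NF.of_norming hP)
  have hyz : y = z := sub_eq_zero.1 hf
  subst hyz
  have : x = y := by
    rw [hxyz, ← add_smul]; simp
  exact ⟨this.symm, this.symm⟩

/-- A positive vector `x ∈ JT` is an extreme point of the ball of radius
`‖x‖_{JT}` if and only if it is separated. -/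
theorem positive_extreme_iff_separated (x : DyadicNode → ℝ) (hx : MemJT x)
    (hpos : ∀ a, 0 ≤ x a) (hx0 : x ≠ 0) :
    IsExtremePoint x ↔ Separated x := by
  exact ⟨extreme_to_sep hx hpos, sep_to_extreme hx hpos hx0⟩

end JTSpace
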